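/- Let G, H be primitive graphs, P : E_G × E_H → ℤ a payoff function, and let μ be a shift-invariant Borel probability measure on the edge shift X_H. Then the following are equivalent: (1a) μ({x ∈ X_H : lim_{n→∞} (1/n)·min M(x_{[1,n]}) = V(G,H,P)}) = 1; (1b) limsup_{n→∞} (1/n)·∫_{X_H} min M(x_{[1,n]}) dμ(x) = V(G,H,P); (1c) μ(X_H†) = 1. -/

import Mathlib

open Filter Set

structure DirGraph (V E : Type) where
  src : E → V
  tgt : E → V

namespace DirGraph

variable {V E : Type}

/-- A (finite) walk: consecutive edges are compatible. -/
def IsWalkList (G : DirGraph V E) (p : List E) : Prop :=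
  p.Chain' fun e f => G.tgt e = G.src f

/-- The set of walks of length `n`. -/
def walks (G : DirGraph V E) (n : ℕ) : Set (List E) :=
  {p | p.length = n ∧ G.IsWalkList p}

/-- The set of walks of length `n` from `v` to `w`. -/
def walksFT (G : DirGraph V E) (n : ℕ) (v w : V) : Set (List E) :=
  {p | p.length = n ∧ G.IsWalkList p ∧
    ∃ h : p ≠ [], G.src (p.head h) = v ∧ G.tgt (p.getLast h) = w}

def IsCycle (G : DirGraph V E) (p : List E) : Prop :=
  G.IsWalkList p ∧ ∃ h : p ≠ [], G.src (p.head h) = G.tgt (p.getLast h)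

def Irreducible (G : DirGraph V E) : Prop :=
  ∀ v w : V, ∃ n : ℕ, (G.walksFT n v w).Nonempty

/-- Irreducible and the gcd of all cycle lengths is 1 (every common divisor of
the cycle lengths equals 1). -/
def Primitive (G : DirGraph V E) : Prop :=
  G.Irreducible ∧ ∀ d : ℕ, (∀ p, G.IsCycle p → d ∣ p.length) → d = 1

end DirGraph

/-- `Σ_i P(q_i, p_i)`. -/
def payoffSum {EG EH : Type} (P : EG → EH → ℤ) (q : List EG) (p : List EH) : ℤ :=
  (List.zipWith P q p).sum

/-- `V_n(G,H,P) = max_{p ∈ W_n(H)} min_{q ∈ W_n(G)} Σ P(q_i,p_i)`. -/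
noncomputable def Vn {VG EG VH EH : Type} (G : DirGraph VG EG) (H : DirGraph VH EH)
    (P : EG → EH → ℤ) (n : ℕ) : ℤ :=
  sSup ((fun p => sInf ((fun q => payoffSum P q p) '' G.walks n)) '' H.walks n)

/-- `M(p)(v,w) = inf {Σ P(q_i,p_i) : q ∈ W_n(G, v → w)}`, with `inf ∅ = ⊤`. -/
noncomputable def Mfun {VG EG EH : Type} (G : DirGraph VG EG) (P : EG → EH → ℤ)
    (p : List EH) : VG → VG → WithTop ℤ :=
  fun v w => sInf ((fun q => ((payoffSum P q p : ℤ) : WithTop ℤ)) '' G.walksFT p.length v w)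

/-- `f < g` pointwise everywhere. -/
def StrictDom {V α : Type} [LT α] (f g : V → V → α) : Prop := ∀ v w, f v w < g v w

/-- `<`-maximal elements of a set w.r.t. a strict domination relation. -/
def maxElems {α : Type} (lt : α → α → Prop) (A : Set α) : Set α :=
  {f ∈ A | ¬ ∃ g ∈ A, lt f g}

/-- Tropical convolution on `(ℤ ∪ {∞})`-valued matrices. -/
noncomputable def tconv {V : Type} (f g : V → V → WithTop ℤ) : V → V → WithTop ℤ :=
  fun u w => sInf (Set.range fun v => f u v + g v w)

/-- Tropical convolution on `ℤ`-valued matrices. -/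
noncomputable def tconvZ {V : Type} (f g : V → V → ℤ) : V → V → ℤ :=
  fun u w => sInf (Set.range fun v => f u v + g v w)

/-- Non-improvable walks in `H` (of any length). -/
noncomputable def walksDagger {VG EG VH EH : Type} (G : DirGraph VG EG) (H : DirGraph VH EH)
    (P : EG → EH → ℤ) : Set (List EH) :=
  {p | ∃ u v : VH, p ∈ H.walksFT p.length u v ∧
    Mfun G P p ∈ maxElems StrictDom (Mfun G P '' H.walksFT p.length u v)}

/-- The edge shift of a graph. -/
def XEdge {V E : Type} (G : DirGraph V E) : Set (ℤ → E) :=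
  {x | ∀ n : ℤ, G.tgt (x n) = G.src (x (n + 1))}

/-- The word `x_{[m,n]}` as a list (of length `n - m + 1` when `m ≤ n`). -/
def seg {A : Type} (x : ℤ → A) (m n : ℤ) : List A :=
  List.ofFn fun i : Fin (n + 1 - m).toNat => x (m + i)

/-- `X_H^†`: points all of whose subwords are non-improvable walks. -/
noncomputable def XHdag {VG EG VH EH : Type} (G : DirGraph VG EG) (H : DirGraph VH EH)
    (P : EG → EH → ℤ) : Set (ℤ → EH) :=
  {x | x ∈ XEdge H ∧ ∀ m n : ℤ, m ≤ n → seg x m n ∈ walksDagger G H P}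

/-- `R(p)`: optimal responses to `p`. -/
noncomputable def Rset {VG EG EH : Type} (G : DirGraph VG EG) (P : EG → EH → ℤ)
    (p : List EH) : Set (List EG) :=
  {q | ∃ v w : VG, q ∈ G.walksFT p.length v w ∧
    ((payoffSum P q p : ℤ) : WithTop ℤ) = Mfun G P p v w}

/-- The Borel (= cylinder) σ-algebra on `ℤ → E` for a discrete alphabet `E`. -/
instance cylMS (E : Type) : MeasurableSpace (ℤ → E) :=
  @MeasurableSpace.pi ℤ (fun _ => E) (fun _ => ⊤)

/-- The shift map. -/
def shiftMap {E : Type} : (ℤ → E) → (ℤ → E) := fun x n => x (n + 1)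

/-- The word `x_{[1,n]}` as a list. -/
def seg1 {A : Type} (x : ℤ → A) (n : ℕ) : List A :=
  List.ofFn fun i : Fin n => x (1 + (i : ℤ))

/-- `min M(p) = min_{v,w} M(p)(v,w) = inf over all length-`|p|` walks `q` of `G` of
`Σ P(q_i, p_i)` (computed in `ℤ`). -/
noncomputable def minM {VG EG EH : Type} (G : DirGraph VG EG) (P : EG → EH → ℤ)
    (p : List EH) : ℤ :=
  sInf ((fun q => payoffSum P q p) '' G.walks p.length)

namespace DirGraph

variable {V E : Type}

/-- `G.Joins v p w`: the possibly empty list of edges `p` is a walk from `v` to `w`. -/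
def Joins (G : DirGraph V E) : V → List E → V → Prop
  | v, [], w => v = w
  | v, e :: l, w => G.src e = v ∧ G.Joins (G.tgt e) l w

theorem joins_append {G : DirGraph V E} {v w : V} {p q : List E} :
    G.Joins v (p ++ q) w ↔ ∃ u, G.Joins v p u ∧ G.Joins u q w := by
  induction p generalizing v with
  | nil => simp [Joins]
  | cons e l ih => simp [Joins, ih, and_assoc]

theorem isWalkList_cons_cons {G : DirGraph V E} {e f : E} {l : List E} :
    G.IsWalkList (e :: f :: l) ↔ G.tgt e = G.src f ∧ G.IsWalkList (f :: l) :=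
  List.isChain_cons_cons

theorem joins_iff_isWalkList (G : DirGraph V E) {p : List E} (h : p ≠ []) {v w : V} :
    G.Joins v p w ↔ G.IsWalkList p ∧ G.src (p.head h) = v ∧ G.tgt (p.getLast h) = w := by
  induction p generalizing v with
  | nil => exact absurd rfl h
  | cons e l ih =>
    cases l with
    | nil => simp [Joins, IsWalkList]; exact fun _ _ => List.isChain_singleton _
    | cons f l =>
      have := ih (List.cons_ne_nil f l) (v := G.tgt e)
      rw [Joins, this]
      simp only [isWalkList_cons_cons, List.head_cons,
        List.getLast_cons (List.cons_ne_nil f l)]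
      constructor
      · rintro ⟨h1, h2, h3, h4⟩
        exact ⟨⟨h3.symm, h2⟩, h1, h4⟩
      · rintro ⟨⟨h3, h2⟩, h1, h4⟩
        exact ⟨h1, h2, h3.symm, h4⟩

theorem mem_walksFT {G : DirGraph V E} {n : ℕ} {v w : V} {p : List E} :
    p ∈ G.walksFT n v w ↔ p.length = n ∧ p ≠ [] ∧ G.Joins v p w := by
  constructor
  · rintro ⟨h1, h2, h, h3⟩
    exact ⟨h1, h, (G.joins_iff_isWalkList h).2 ⟨h2, h3⟩⟩
  · rintro ⟨h1, h, h2⟩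
    have := (G.joins_iff_isWalkList h).1 h2
    exact ⟨h1, this.1, h, this.2⟩

theorem mem_walks [Nonempty V] {G : DirGraph V E} {n : ℕ} {p : List E} :
    p ∈ G.walks n ↔ p.length = n ∧ ∃ v w, G.Joins v p w := by
  refine and_congr_right fun _ => ?_
  rcases eq_or_ne p [] with rfl | h
  · simpa [Joins] using (show G.IsWalkList [] from List.isChain_nil)
  · simp [G.joins_iff_isWalkList h]

theorem isCycle_iff {G : DirGraph V E} {p : List E} :
    G.IsCycle p ↔ p ≠ [] ∧ ∃ v, G.Joins v p v := by
  constructor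
  · rintro ⟨h, hne, heq⟩
    exact ⟨hne, _, (G.joins_iff_isWalkList hne).2 ⟨h, rfl, heq.symm⟩⟩
  · rintro ⟨hne, v, h⟩
    have := (G.joins_iff_isWalkList hne).1 h
    exact ⟨this.1, hne, this.2.1.trans this.2.2.symm⟩

theorem finite_walks [Finite E] (G : DirGraph V E) (n : ℕ) : (G.walks n).Finite :=
  (List.finite_length_eq E n).subset fun _ h => h.1

theorem finite_walksFT [Finite E] (G : DirGraph V E) (n : ℕ) (v w : V) :
    (G.walksFT n v w).Finite :=
  (List.finite_length_eq E n).subset fun _ h => h.1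

theorem Irreducible.exists_joins {G : DirGraph V E} (hG : G.Irreducible) (v w : V) :
    ∃ p, p ≠ [] ∧ G.Joins v p w := by
  obtain ⟨n, p, hp⟩ := hG v w
  exact ⟨p, (mem_walksFT.1 hp).2⟩

theorem Primitive.nonempty {G : DirGraph V E} (hG : G.Primitive) : Nonempty V := by
  by_contra h
  rw [not_nonempty_iff] at h
  refine absurd (hG.2 0 fun p hp => ?_) zero_ne_one
  obtain ⟨_, v, _⟩ := isCycle_iff.1 hp
  exact h.elim v

theorem Primitive.exists_joins_self {G : DirGraph V E} (hG : G.Primitive) (v : V) :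
    ∃ N, ∀ n ≥ N, ∃ p, p.length = n ∧ G.Joins v p v := by
  let S : AddSubmonoid ℕ :=
    { carrier := {n | ∃ p, p.length = n ∧ G.Joins v p v}
      zero_mem' := ⟨[], rfl, rfl⟩
      add_mem' := by
        rintro a b ⟨p, rfl, hp⟩ ⟨q, rfl, hq⟩
        exact ⟨p ++ q, List.length_append, joins_append.2 ⟨v, hp, hq⟩⟩ }
  have hgcd : Nat.setGcd (S : Set ℕ) = 1 := by
    refine hG.2 _ fun p hp => ?_
    obtain ⟨_, u, hu⟩ := isCycle_iff.1 hp
    obtain ⟨a, -, ha⟩ := hG.1.exists_joins v u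
    obtain ⟨b, -, hb⟩ := hG.1.exists_joins u v
    have h1 : (a ++ b).length ∈ S := ⟨_, rfl, joins_append.2 ⟨u, ha, hb⟩⟩
    have h2 : (a ++ (p ++ b)).length ∈ S :=
      ⟨_, rfl, joins_append.2 ⟨u, ha, joins_append.2 ⟨u, hu, hb⟩⟩⟩
    have h3 := Nat.setGcd_dvd_of_mem (s := S) h1
    have h4 := Nat.setGcd_dvd_of_mem (s := S) h2
    refine (Nat.dvd_add_right h3).1 ?_
    convert h4 using 1
    simp only [List.length_append]
    ring
  obtain ⟨N, hN⟩ := Nat.exists_mem_closure_of_ge (S : Set ℕ)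
  refine ⟨N, fun n hn => ?_⟩
  have := hN n hn (by simp [hgcd])
  rwa [AddSubmonoid.closure_eq] at this

theorem Primitive.exists_joins_of_ge [Finite V] {G : DirGraph V E} (hG : G.Primitive) :
    ∃ N, ∀ n ≥ N, ∀ v w, ∃ p, p.length = n ∧ G.Joins v p w := by
  have h : ∀ vw : V × V, ∃ N, ∀ n ≥ N, ∃ p, p.length = n ∧ G.Joins vw.1 p vw.2 := by
    rintro ⟨v, w⟩
    obtain ⟨N, hN⟩ := hG.exists_joins_self v
    obtain ⟨a, -, ha⟩ := hG.1.exists_joins v w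
    refine ⟨N + a.length, fun n hn => ?_⟩
    obtain ⟨p, hp, hp'⟩ := hN (n - a.length) (by omega)
    exact ⟨p ++ a, by rw [List.length_append]; omega, joins_append.2 ⟨v, hp', ha⟩⟩
  choose N hN using h
  obtain ⟨M, hM⟩ := (Set.finite_range N).bddAbove
  exact ⟨M, fun n hn v w => hN (v, w) n (le_trans (hM ⟨_, rfl⟩) hn)⟩

theorem Primitive.nonempty_walks [Finite V] {G : DirGraph V E} (hG : G.Primitive) (n : ℕ) :
    (G.walks n).Nonempty := by
  have := hG.nonempty
  obtain ⟨N, hN⟩ := hG.exists_joins_of_ge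
  obtain ⟨v⟩ := hG.nonempty
  obtain ⟨p, hp, hj⟩ := hN (n + N) (by omega) v v
  rw [← List.take_append_drop n p, joins_append] at hj
  obtain ⟨u, hu, -⟩ := hj
  exact ⟨p.take n, mem_walks.2 ⟨by rw [List.length_take]; omega, v, u, hu⟩⟩

theorem _root_.List.exists_eq_append_append {A : Type} (p : List A) {N : ℕ}
    (h : 2 * N ≤ p.length) :
    ∃ a m b, a.length = N ∧ m.length = p.length - 2 * N ∧ b.length = N ∧ p = a ++ m ++ b :=
  ⟨p.take N, (p.drop N).take (p.length - 2 * N), (p.drop N).drop (p.length - 2 * N),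
    by simp; omega, by simp; omega, by simp; omega, by
    rw [List.append_assoc, List.take_append_drop, List.take_append_drop]⟩

/-- If all pairs of vertices are joined by walks of length `N`, then any walk of length at least
`2 * N` can be given prescribed endpoints by changing its first and last `N` edges. -/
theorem Joins.exists_splice {G : DirGraph V E} {N : ℕ}
    (hN : ∀ v w, ∃ p, p.length = N ∧ G.Joins v p w) {p : List E} (hp : 2 * N ≤ p.length)
    {v w : V} (h : G.Joins v p w) (v' w' : V) :
    ∃ a m b a' b', a.length = N ∧ m.length = p.length - 2 * N ∧ b.length = N ∧
      p = a ++ m ++ b ∧ a'.length = N ∧ b'.length = N ∧ G.Joins v' (a' ++ m ++ b') w' := by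
  obtain ⟨a, m, b, ha, hm, hb, hpe⟩ := p.exists_eq_append_append hp
  rw [hpe, joins_append] at h
  obtain ⟨u', h, -⟩ := h
  obtain ⟨u, -, h⟩ := joins_append.1 h
  obtain ⟨a', ha', hj⟩ := hN v' u
  obtain ⟨b', hb', hj'⟩ := hN u' w'
  exact ⟨a, m, b, a', b', ha, hm, hb, hpe, ha', hb',
    joins_append.2 ⟨u', joins_append.2 ⟨u, hj, h⟩, hj'⟩⟩

end DirGraph

section Payoff

variable {VG EG VH EH : Type} {G : DirGraph VG EG} {H : DirGraph VH EH} {P : EG → EH → ℤ}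

theorem payoffSum_append {q₁ q₂ : List EG} {p₁ p₂ : List EH} (h : q₁.length = p₁.length) :
    payoffSum P (q₁ ++ q₂) (p₁ ++ p₂) = payoffSum P q₁ p₁ + payoffSum P q₂ p₂ := by
  simp [payoffSum, List.zipWith_append h]

theorem abs_payoffSum_le {K : ℤ} (hK : ∀ e f, |P e f| ≤ K) (q : List EG) (p : List EH)
    (h : q.length = p.length) : |payoffSum P q p| ≤ K * q.length := by
  induction q generalizing p with
  | nil => simp [payoffSum]
  | cons e q ih =>
    cases p with
    | nil => simp at h
    | cons f p =>
      have h1 := ih p (by simpa using h)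
      have h2 := hK e f
      have h3 : payoffSum P (e :: q) (f :: p) = P e f + payoffSum P q p := by simp [payoffSum]
      rw [h3, List.length_cons]
      push_cast
      linarith [abs_add_le (P e f) (payoffSum P q p)]

theorem minM_le [Finite EG] {p : List EH} {q : List EG} (hq : q ∈ G.walks p.length) :
    minM G P p ≤ payoffSum P q p :=
  csInf_le ((G.finite_walks _).image _).bddBelow ⟨q, hq, rfl⟩

theorem exists_payoffSum_eq_minM [Finite VG] [Finite EG] (hG : G.Primitive) (P : EG → EH → ℤ)
    (p : List EH) : ∃ q ∈ G.walks p.length, payoffSum P q p = minM G P p :=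
  ((hG.nonempty_walks _).image _).csInf_mem ((G.finite_walks _).image _)

theorem abs_minM_le [Finite VG] [Finite EG] (hG : G.Primitive) {K : ℤ}
    (hK : ∀ e f, |P e f| ≤ K) (p : List EH) : |minM G P p| ≤ K * p.length := by
  obtain ⟨q, hq, h⟩ := exists_payoffSum_eq_minM hG P p
  rw [← h, ← hq.1]
  exact abs_payoffSum_le hK q p hq.1

theorem Vn_eq (G : DirGraph VG EG) (H : DirGraph VH EH) (P : EG → EH → ℤ) (n : ℕ) :
    Vn G H P n = sSup (minM G P '' H.walks n) := by
  unfold Vn minM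
  congr 1
  refine Set.image_congr fun p hp => ?_
  rw [hp.1]

theorem minM_le_Vn [Finite EH] {n : ℕ} {p : List EH} (hp : p ∈ H.walks n) :
    minM G P p ≤ Vn G H P n := by
  rw [Vn_eq]
  exact le_csSup ((H.finite_walks _).image _).bddAbove ⟨p, hp, rfl⟩

theorem exists_minM_eq_Vn [Finite VH] [Finite EH] (hH : H.Primitive) (G : DirGraph VG EG)
    (P : EG → EH → ℤ) (n : ℕ) : ∃ p ∈ H.walks n, minM G P p = Vn G H P n := by
  rw [Vn_eq]
  exact ((hH.nonempty_walks _).image _).csSup_mem ((H.finite_walks _).image _)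

theorem Mfun_lt_of_forall [Finite EG] {n : ℕ} {p p' : List EH} (hp : p.length = n)
    (hp' : p'.length = n) {v w : VG} (hne : (G.walksFT n v w).Nonempty)
    (h : ∀ q' ∈ G.walksFT n v w, ∃ q ∈ G.walksFT n v w, payoffSum P q p < payoffSum P q' p') :
    Mfun G P p v w < Mfun G P p' v w := by
  unfold Mfun
  rw [hp, hp']
  obtain ⟨q', hq', h'⟩ := (hne.image fun q => ((payoffSum P q p' : ℤ) : WithTop ℤ)).csInf_mem
    ((G.finite_walksFT _ _ _).image _)
  rw [← h']
  obtain ⟨q, hq, hlt⟩ := h q' hq'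
  exact lt_of_le_of_lt (csInf_le ((G.finite_walksFT _ _ _).image _).bddBelow ⟨q, hq, rfl⟩)
    (WithTop.coe_lt_coe.2 hlt)

theorem exists_payoffSum_lt_of_Mfun_lt [Finite EG] {n : ℕ} {p p' : List EH} (hp : p.length = n)
    (hp' : p'.length = n) {v w : VG} (h : Mfun G P p v w < Mfun G P p' v w) {q' : List EG}
    (hq' : q' ∈ G.walksFT n v w) :
    ∃ q ∈ G.walksFT n v w, payoffSum P q p < payoffSum P q' p' := by
  unfold Mfun at h
  rw [hp, hp'] at h
  obtain ⟨q, hq, h'⟩ := (Set.Nonempty.image (fun q => ((payoffSum P q p : ℤ) : WithTop ℤ))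
    ⟨q', hq'⟩).csInf_mem ((G.finite_walksFT _ _ _).image _)
  refine ⟨q, hq, ?_⟩
  rw [← h'] at h
  exact WithTop.coe_lt_coe.1 (lt_of_lt_of_le h
    (csInf_le ((G.finite_walksFT _ _ _).image _).bddBelow ⟨q', hq', rfl⟩))

/-- Two pairs of lists which agree away from their first and last `N` entries have nearly equal
payoffs. -/
theorem payoffSum_le_of_splice {K : ℤ} (hK : ∀ e f, |P e f| ≤ K) {N : ℕ}
    {a b a' b' m : List EG} {c d c' d' r : List EH}
    (ha : a.length = N) (hb : b.length = N) (ha' : a'.length = N) (hb' : b'.length = N)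
    (hc : c.length = N) (hd : d.length = N) (hc' : c'.length = N) (hd' : d'.length = N)
    (h : m.length = r.length) :
    payoffSum P (a' ++ m ++ b') (c' ++ r ++ d') ≤
      payoffSum P (a ++ m ++ b) (c ++ r ++ d) + 4 * N * K := by
  have h1 := abs_le.1 (abs_payoffSum_le hK a c (by omega))
  have h2 := abs_le.1 (abs_payoffSum_le hK b d (by omega))
  have h3 := abs_le.1 (abs_payoffSum_le hK a' c' (by omega))
  have h4 := abs_le.1 (abs_payoffSum_le hK b' d' (by omega))
  rw [payoffSum_append (by simp; omega), payoffSum_append (by omega),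
    payoffSum_append (by simp; omega), payoffSum_append (by omega)]
  rw [ha] at h1
  rw [hb] at h2
  rw [ha'] at h3
  rw [hb'] at h4
  linarith [h1.1, h2.1, h3.2, h4.2]

theorem exists_mem_walksFT_payoffSum_le [Finite VG] [Finite EG] (hG : G.Primitive) {K : ℤ}
    (hK : ∀ e f, |P e f| ≤ K) {N : ℕ} (hN0 : 0 < N)
    (hN : ∀ v w, ∃ p, p.length = N ∧ G.Joins v p w) {p : List EH} (hp : 2 * N ≤ p.length)
    (v w : VG) :
    ∃ q ∈ G.walksFT p.length v w, payoffSum P q p ≤ minM G P p + 4 * N * K := by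
  have := hG.nonempty
  obtain ⟨q, hq, hqp⟩ := exists_payoffSum_eq_minM hG P p
  obtain ⟨hql, q₁, q₂, hqj⟩ := DirGraph.mem_walks.1 hq
  obtain ⟨a, m, b, a', b', ha, hm, hb, hqe, ha', hb', hj⟩ :=
    hqj.exists_splice hN (by omega) v w
  obtain ⟨c, r, d, hc, hr, hd, hpe⟩ := p.exists_eq_append_append hp
  refine ⟨a' ++ m ++ b', DirGraph.mem_walksFT.2 ⟨?_, ?_, hj⟩, ?_⟩
  · simp only [List.length_append]
    omega
  · rw [← List.length_pos_iff]
    simp only [List.length_append]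
    omega
  · have h := payoffSum_le_of_splice hK ha hb ha' hb' hc hd hc hd
      (show m.length = r.length by omega)
    rwa [← hpe, ← hqe, hqp] at h

theorem exists_mem_walksFT_forall_payoffSum_le {K : ℤ} (hK : ∀ e f, |P e f| ≤ K) {N : ℕ}
    (hN0 : 0 < N) (hN : ∀ v w, ∃ p, p.length = N ∧ H.Joins v p w) {p : List EH} {u v : VH}
    (hpj : H.Joins u p v) (hp : 2 * N ≤ p.length) (u' v' : VH) :
    ∃ p' ∈ H.walksFT p.length u' v', ∀ q : List EG, q.length = p.length →
      payoffSum P q p ≤ payoffSum P q p' + 4 * N * K := by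
  obtain ⟨a, m, b, a', b', ha, hm, hb, hpe, ha', hb', hj⟩ := hpj.exists_splice hN hp u' v'
  refine ⟨a' ++ m ++ b', DirGraph.mem_walksFT.2 ⟨?_, ?_, hj⟩, fun q hq => ?_⟩
  · simp only [List.length_append]
    omega
  · rw [← List.length_pos_iff]
    simp only [List.length_append]
    omega
  · obtain ⟨c, r, d, hc, hr, hd, hqe⟩ := q.exists_eq_append_append (N := N) (by omega)
    have h := payoffSum_le_of_splice hK hc hd hc hd ha' hb' ha hb
      (show r.length = m.length by omega)
    rwa [← hpe, ← hqe] at h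

/-- The minimal payoff of a non-improvable walk is within a constant of the optimal value. -/
theorem Vn_le_minM_add [Finite EG] [Finite VG] [Finite VH] [Finite EH] (hG : G.Primitive)
    (hH : H.Primitive) {K : ℤ} (hK : ∀ e f, |P e f| ≤ K) {N : ℕ} (hN0 : 0 < N)
    (hGN : ∀ v w, ∃ p, p.length = N ∧ G.Joins v p w)
    (hHN : ∀ v w, ∃ p, p.length = N ∧ H.Joins v p w)
    {p : List EH} (hp : p ∈ walksDagger G H P) (hn : 2 * N ≤ p.length) :
    Vn G H P p.length ≤ minM G P p + 8 * N * K := by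
  have := hG.nonempty
  have := hH.nonempty
  by_contra! hlt
  obtain ⟨u, v, hpw, -, hmax⟩ := hp
  obtain ⟨s, hs, hsV⟩ := exists_minM_eq_Vn hH G P p.length
  obtain ⟨hsl, s₁, s₂, hsj⟩ := DirGraph.mem_walks.1 hs
  obtain ⟨p', hp', hp's⟩ := exists_mem_walksFT_forall_payoffSum_le hK hN0 hHN hsj (by omega) u v
  rw [hsl] at hp' hp's
  refine hmax ⟨_, ⟨p', hp', rfl⟩, fun x y => ?_⟩
  obtain ⟨q, hq, hqp⟩ := exists_mem_walksFT_payoffSum_le hG hK hN0 hGN hn x y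
  refine Mfun_lt_of_forall rfl hp'.1 ⟨q, hq⟩ fun q' hq' => ⟨q, hq, ?_⟩
  have h₁ := hp's q' hq'.1
  have h₂ : minM G P s ≤ payoffSum P q' s :=
    minM_le (DirGraph.mem_walks.2 ⟨hq'.1.trans hsl.symm, x, y, (DirGraph.mem_walksFT.1 hq').2.2⟩)
  linarith

/-- `p'` is a walk with the same endpoints as `p` which improves on it by at least `c`, whatever
the endpoints of the response. -/
def ImprovesBy (G : DirGraph VG EG) (H : DirGraph VH EH) (P : EG → EH → ℤ) (c : ℤ)
    (p p' : List EH) : Prop :=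
  p'.length = p.length ∧ (∀ u v, H.Joins u p v → H.Joins u p' v) ∧
    ∀ v w q', q'.length = p'.length → G.Joins v q' w →
      ∃ q, q.length = p.length ∧ G.Joins v q w ∧ payoffSum P q p + c ≤ payoffSum P q' p'

theorem ImprovesBy.refl (G : DirGraph VG EG) (H : DirGraph VH EH) (P : EG → EH → ℤ)
    (p : List EH) : ImprovesBy G H P 0 p p :=
  ⟨rfl, fun _ _ h => h, fun _ _ q' hl h => ⟨q', hl, h, by simp⟩⟩

theorem ImprovesBy.append {c₁ c₂ : ℤ} {p₁ p₁' p₂ p₂' : List EH} (h₁ : ImprovesBy G H P c₁ p₁ p₁')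
    (h₂ : ImprovesBy G H P c₂ p₂ p₂') :
    ImprovesBy G H P (c₁ + c₂) (p₁ ++ p₂) (p₁' ++ p₂') := by
  refine ⟨by simp [h₁.1, h₂.1], fun u v h => ?_, fun v w q' hl h => ?_⟩
  · obtain ⟨x, hx, hy⟩ := DirGraph.joins_append.1 h
    exact DirGraph.joins_append.2 ⟨x, h₁.2.1 _ _ hx, h₂.2.1 _ _ hy⟩
  · rw [List.length_append] at hl
    rw [← List.take_append_drop p₁'.length q'] at h ⊢
    obtain ⟨x, hx, hy⟩ := DirGraph.joins_append.1 h
    have hl₁ : (q'.take p₁'.length).length = p₁'.length := by simp; omega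
    obtain ⟨q₁, hq₁, hj₁, hc₁⟩ := h₁.2.2 _ _ _ hl₁ hx
    obtain ⟨q₂, hq₂, hj₂, hc₂⟩ := h₂.2.2 _ _ _ (by simp; omega) hy
    refine ⟨q₁ ++ q₂, by simp [hq₁, hq₂], DirGraph.joins_append.2 ⟨x, hj₁, hj₂⟩, ?_⟩
    rw [payoffSum_append hq₁, payoffSum_append hl₁]
    linarith

theorem ImprovesBy.minM_add_le [Finite VG] [Finite EG] (hG : G.Primitive) {c : ℤ}
    {p p' : List EH} (h : ImprovesBy G H P c p p') : minM G P p + c ≤ minM G P p' := by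
  have := hG.nonempty
  obtain ⟨q', hq', h'⟩ := exists_payoffSum_eq_minM hG P p'
  obtain ⟨hl, v, w, hj⟩ := DirGraph.mem_walks.1 hq'
  obtain ⟨q, hq, hqj, hc⟩ := h.2.2 v w q' hl hj
  have := minM_le (P := P) (DirGraph.mem_walks.2 ⟨hq, v, w, hqj⟩)
  linarith

theorem exists_improvesBy_one [Finite EG] {p : List EH} {u v : VH} (hne : p ≠ [])
    (hp : H.Joins u p v) (h : p ∉ walksDagger G H P) : ∃ p', ImprovesBy G H P 1 p p' := by
  have hpw : p ∈ H.walksFT p.length u v := DirGraph.mem_walksFT.2 ⟨rfl, hne, hp⟩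
  by_contra hcon
  refine h ⟨u, v, hpw, ⟨_, hpw, rfl⟩, ?_⟩
  rintro ⟨_, ⟨p', hp', rfl⟩, hdom⟩
  have hp'' := DirGraph.mem_walksFT.1 hp'
  refine hcon ⟨p', hp''.1, fun x y hxy => ?_, fun x y q' hl hj => ?_⟩
  · obtain ⟨-, h1, h2⟩ := (H.joins_iff_isWalkList hne).1 hp
    obtain ⟨-, h3, h4⟩ := (H.joins_iff_isWalkList hne).1 hxy
    rw [← h3, ← h4, h1, h2]
    exact hp''.2.2
  · have hq'ne : q' ≠ [] := by
      rw [← List.length_pos_iff, hl, hp''.1]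
      exact List.length_pos_iff.2 hne
    obtain ⟨q, hq, hlt⟩ := exists_payoffSum_lt_of_Mfun_lt rfl hp''.1 (hdom x y)
      (DirGraph.mem_walksFT.2 ⟨hl.trans hp''.1, hq'ne, hj⟩)
    have := DirGraph.mem_walksFT.1 hq
    exact ⟨q, this.1, this.2.2, hlt⟩

end Payoff

section Block

variable {VG EG VH EH : Type} {G : DirGraph VG EG} {H : DirGraph VH EH} {P : EG → EH → ℤ}

/-- The word of length `n` in `x` starting at position `s`. -/
def block {A : Type} (x : ℤ → A) (s : ℤ) (n : ℕ) : List A :=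
  List.ofFn fun i : Fin n => x (s + (i : ℤ))

theorem length_block {A : Type} (x : ℤ → A) (s : ℤ) (n : ℕ) : (block x s n).length = n :=
  List.length_ofFn

theorem block_add {A : Type} (x : ℤ → A) (s : ℤ) (a b : ℕ) :
    block x s (a + b) = block x s a ++ block x (s + a) b := by
  simp [block, List.ofFn_add, add_assoc]

theorem joins_block {x : ℤ → EH} (hx : x ∈ XEdge H) (s : ℤ) (n : ℕ) :
    H.Joins (H.src (x s)) (block x s n) (H.src (x (s + n))) := by
  induction n with
  | zero => simp [block, DirGraph.Joins]
  | succ n ih =>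
    rw [block_add]
    refine DirGraph.joins_append.2 ⟨_, ih, ?_⟩
    have := hx (s + n)
    simpa [block, DirGraph.Joins, add_assoc] using this

theorem block_mem_walks [Nonempty VH] {x : ℤ → EH} (hx : x ∈ XEdge H) (s : ℤ) (n : ℕ) :
    block x s n ∈ H.walks n :=
  DirGraph.mem_walks.2 ⟨length_block x s n, _, _, joins_block hx s n⟩

open Classical in
theorem exists_improvesBy_block {w w' : List EH} (hw : ImprovesBy G H P 1 w w') (x : ℤ → EH)
    (k : ℕ) : ∃ p', ImprovesBy G H P
      (∑ i ∈ Finset.range k, if block x (1 + (i * w.length : ℕ)) w.length = w then 1 else 0)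
      (block x 1 (k * w.length)) p' := by
  induction k with
  | zero => exact ⟨_, by simpa using ImprovesBy.refl G H P _⟩
  | succ k ih =>
    obtain ⟨p', hp'⟩ := ih
    rw [Finset.sum_range_succ, Nat.succ_mul, block_add]
    by_cases h : block x (1 + (k * w.length : ℕ)) w.length = w
    · rw [if_pos h]
      exact ⟨p' ++ w', hp'.append (h.symm ▸ hw)⟩
    · rw [if_neg h]
      exact ⟨_, hp'.append (ImprovesBy.refl G H P _)⟩

open Classical in
theorem minM_block_add_le [Finite VG] [Finite EG] [Finite EH] (hG : G.Primitive)
    [Nonempty VH] {w w' : List EH} (hw : ImprovesBy G H P 1 w w') {x : ℤ → EH}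
    (hx : x ∈ XEdge H) (n : ℕ) :
    minM G P (block x 1 n) + (∑ i ∈ Finset.range (n / w.length),
      if block x (1 + (i * w.length : ℕ)) w.length = w then 1 else 0) ≤ Vn G H P n := by
  obtain ⟨p', hp'⟩ := exists_improvesBy_block hw x (n / w.length)
  have h := hp'.append (ImprovesBy.refl G H P
    (block x (1 + (n / w.length * w.length : ℕ)) (n % w.length)))
  rw [← block_add, Nat.div_add_mod', add_zero] at h
  refine (h.minM_add_le hG).trans (minM_le_Vn (DirGraph.mem_walks.2 ⟨?_, _, _,
    h.2.1 _ _ (joins_block hx 1 n)⟩))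
  rw [h.1, length_block]

theorem measurable_comp_block [Finite EH] {β : Type} [MeasurableSpace β] (f : List EH → β)
    (s : ℤ) (n : ℕ) : Measurable fun x : ℤ → EH => f (block x s n) := by
  let : MeasurableSpace EH := ⊤
  have h : Measurable fun y : Fin n → EH => f (List.ofFn y) := measurable_of_countable _
  have h' : @Measurable (ℤ → EH) (Fin n → EH) (cylMS EH) _
      (fun x (i : Fin n) => x (s + (i : ℤ))) :=
    measurable_pi_lambda _ fun i => measurable_pi_apply _
  exact h.comp h'

theorem measurableSet_block_eq [Finite EH] (s : ℤ) (n : ℕ) (w : List EH) :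
    MeasurableSet {x : ℤ → EH | block x s n = w} :=
  measurableSet_setOfPred.2 (measurable_comp_block (fun l => l = w) s n)

theorem measurableSet_XEdge [Finite EH] (H : DirGraph VH EH) : MeasurableSet (XEdge H) := by
  have h : XEdge H = ⋂ n : ℤ, {x | H.IsWalkList (block x n 2)} := by
    ext x
    simp [XEdge, block, DirGraph.isWalkList_cons_cons]
    refine forall_congr' fun n => (and_iff_left (List.isChain_singleton _)).symm
  rw [h]
  exact MeasurableSet.iInter fun n =>
    measurableSet_setOfPred.2 (measurable_comp_block (fun l => H.IsWalkList l) n 2)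

open MeasureTheory in
theorem measure_block_eq [Finite EH] {μ : Measure (ℤ → EH)}
    (hinv : ∀ A : Set (ℤ → EH), MeasurableSet A → μ (shiftMap ⁻¹' A) = μ A) (s : ℤ) (n : ℕ)
    (w : List EH) : μ {x | block x s n = w} = μ {x | block x 0 n = w} := by
  have h : ∀ s : ℤ, μ {x | block x (s + 1) n = w} = μ {x | block x s n = w} := fun s => by
    rw [← hinv _ (measurableSet_block_eq s n w)]
    congr 1
    ext x
    simp [block, shiftMap, add_right_comm]
  induction s with
  | zero => rfl
  | succ i ih => rw [h, ih]
  | pred i ih => rw [← ih, ← h (-(i : ℤ) - 1), sub_add_cancel]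

open MeasureTheory in
theorem integrable_minM_block [Finite VG] [Finite EG] [Finite EH] (hG : G.Primitive)
    {K : ℤ} (hK : ∀ e f, |P e f| ≤ K) (μ : Measure (ℤ → EH)) [IsFiniteMeasure μ] (n : ℕ) :
    Integrable (fun x => (minM G P (block x 1 n) : ℝ)) μ := by
  refine Integrable.of_bound (C := K * n)
    (measurable_comp_block (fun l => (minM G P l : ℝ)) 1 n).aestronglyMeasurable
    (Eventually.of_forall fun x => ?_)
  have := abs_minM_le hG hK (block x 1 n)
  rw [length_block] at this
  rw [Real.norm_eq_abs]
  exact_mod_cast this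

open MeasureTheory in
theorem integral_minM_block_add_le [Finite VG] [Finite EG] [Finite EH] (hG : G.Primitive)
    [Nonempty VH] {K : ℤ} (hK : ∀ e f, |P e f| ≤ K) {μ : Measure (ℤ → EH)}
    [IsProbabilityMeasure μ] (hsupp : ∀ᵐ x ∂μ, x ∈ XEdge H)
    (hinv : ∀ A : Set (ℤ → EH), MeasurableSet A → μ (shiftMap ⁻¹' A) = μ A)
    {w w' : List EH} (hw : ImprovesBy G H P 1 w w') (n : ℕ) :
    (∫ x, (minM G P (block x 1 n) : ℝ) ∂μ) +
      (n / w.length : ℕ) * μ.real {x | block x 0 w.length = w} ≤ Vn G H P n := by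
  have hind : ∀ i : ℕ, Integrable ({x : ℤ → EH | block x (1 + (i * w.length : ℕ)) w.length =
      w}.indicator fun _ => (1 : ℝ)) μ := fun i =>
    (integrable_const 1).indicator (measurableSet_block_eq _ _ _)
  have hsum : ∫ x, ∑ i ∈ Finset.range (n / w.length),
      {x : ℤ → EH | block x (1 + (i * w.length : ℕ)) w.length = w}.indicator
        (fun _ => (1 : ℝ)) x ∂μ = (n / w.length : ℕ) * μ.real {x | block x 0 w.length = w} := by
    rw [integral_finsetSum _ fun i _ => hind i]
    have : ∀ i : ℕ, ∫ x, {x : ℤ → EH | block x (1 + (i * w.length : ℕ)) w.length =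
        w}.indicator (fun _ => (1 : ℝ)) x ∂μ = μ.real {x | block x 0 w.length = w} := fun i => by
      rw [integral_indicator_const _ (measurableSet_block_eq _ _ _), Measure.real,
        measure_block_eq hinv, Measure.real, smul_eq_mul, mul_one]
    rw [Finset.sum_congr rfl fun i _ => this i, Finset.sum_const, Finset.card_range, nsmul_eq_mul]
  rw [← hsum, ← integral_add (integrable_minM_block hG hK μ n)
    (integrable_finsetSum _ fun i _ => hind i)]
  calc _ ≤ ∫ _, (Vn G H P n : ℝ) ∂μ := by
        refine integral_mono_ae ((integrable_minM_block hG hK μ n).add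
          (integrable_finsetSum _ fun i _ => hind i)) (integrable_const _) ?_
        filter_upwards [hsupp] with x hx
        have h := minM_block_add_le hG hw hx n
        refine le_trans (le_of_eq ?_) (Int.cast_le.2 h)
        classical simp [Set.indicator_apply]
    _ = _ := by simp

theorem seg1_eq_block {A : Type} (x : ℤ → A) (n : ℕ) : seg1 x n = block x 1 n := rfl

theorem seg_eq_block {A : Type} (x : ℤ → A) (m n : ℤ) :
    seg x m n = block x m (n + 1 - m).toNat := rfl

theorem tendsto_minM_of_mem_XHdag [Finite VG] [Finite EG] [Finite VH] [Finite EH]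
    (hG : G.Primitive) (hH : H.Primitive) {K : ℤ} (hK : ∀ e f, |P e f| ≤ K) {V : ℝ}
    (hV : Tendsto (fun n : ℕ => (Vn G H P n : ℝ) / n) atTop (nhds V)) {x : ℤ → EH}
    (hx : x ∈ XHdag G H P) :
    Tendsto (fun n : ℕ => (minM G P (seg1 x n) : ℝ) / n) atTop (nhds V) := by
  have := hH.nonempty
  obtain ⟨N₁, hN₁⟩ := hG.exists_joins_of_ge
  obtain ⟨N₂, hN₂⟩ := hH.exists_joins_of_ge
  set N := N₁ + N₂ + 1 with hN
  have hlow : Tendsto (fun n : ℕ => (Vn G H P n : ℝ) / n - (8 * N * K : ℤ) / n) atTop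
      (nhds V) := by
    simpa using hV.sub (tendsto_const_div_atTop_nhds_zero_nat ((8 * N * K : ℤ) : ℝ))
  refine tendsto_of_tendsto_of_tendsto_of_le_of_le' hlow hV ?_ ?_
  · filter_upwards [eventually_ge_atTop (2 * N)] with n hn
    have hmem : block x 1 n ∈ walksDagger G H P := by
      have := hx.2 1 n (by omega)
      rwa [seg_eq_block, show ((n : ℤ) + 1 - 1).toNat = n by omega] at this
    have h := Vn_le_minM_add hG hH hK (N := N) (by omega) (hN₁ N (by omega)) (hN₂ N (by omega))
      hmem (by rwa [length_block])
    rw [length_block] at h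
    rw [← sub_div, seg1_eq_block]
    have h' : (Vn G H P n : ℝ) - (8 * N * K : ℤ) ≤ minM G P (block x 1 n) := by
      rw [sub_le_iff_le_add]
      exact_mod_cast h
    gcongr
  · filter_upwards with n
    have h : (minM G P (seg1 x n) : ℝ) ≤ Vn G H P n :=
      Int.cast_le.2 (minM_le_Vn (block_mem_walks hx.1 1 n))
    gcongr

open MeasureTheory in
theorem tendsto_integral_minM [Finite VG] [Finite EG] [Finite EH]
    (hG : G.Primitive) {K : ℤ} (hK : ∀ e f, |P e f| ≤ K) {V : ℝ} {μ : Measure (ℤ → EH)}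
    [IsProbabilityMeasure μ]
    (h : ∀ᵐ x ∂μ, Tendsto (fun n : ℕ => (minM G P (seg1 x n) : ℝ) / n) atTop (nhds V)) :
    Tendsto (fun n : ℕ => (∫ x, (minM G P (seg1 x n) : ℝ) ∂μ) / n) atTop (nhds V) := by
  have := tendsto_integral_of_dominated_convergence
    (F := fun (n : ℕ) x => (minM G P (seg1 x n) : ℝ) / n) (f := fun _ => V) (μ := μ)
    (fun _ => |(K : ℝ)|)
    (fun n => ((integrable_minM_block hG hK μ n).div_const _).aestronglyMeasurable)
    (integrable_const _) (fun n => Eventually.of_forall fun x => ?_) h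
  · simpa [integral_div] using this
  · have h := abs_minM_le hG hK (block x 1 n)
    rw [length_block] at h
    have h' : |(minM G P (seg1 x n) : ℝ)| ≤ |(K : ℝ)| * n := by
      refine le_trans (b := (K : ℝ) * n) (by exact_mod_cast h) ?_
      gcongr
      exact le_abs_self _
    rw [Real.norm_eq_abs, abs_div, Nat.abs_cast]
    exact div_le_of_le_mul₀ (by positivity) (by positivity) h'

open MeasureTheory in
theorem limsup_integral_minM_lt [Finite VG] [Finite EG] [Finite EH] (hG : G.Primitive)
    [Nonempty VH] {K : ℤ} (hK : ∀ e f, |P e f| ≤ K) {V : ℝ}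
    (hV : Tendsto (fun n : ℕ => (Vn G H P n : ℝ) / n) atTop (nhds V)) {μ : Measure (ℤ → EH)}
    [IsProbabilityMeasure μ] (hsupp : ∀ᵐ x ∂μ, x ∈ XEdge H)
    (hinv : ∀ A : Set (ℤ → EH), MeasurableSet A → μ (shiftMap ⁻¹' A) = μ A)
    {w w' : List EH} (hne : w ≠ []) (hw : ImprovesBy G H P 1 w w')
    (hpos : 0 < μ.real {x | block x 0 w.length = w}) :
    limsup (fun n : ℕ => (∫ x, (minM G P (seg1 x n) : ℝ) ∂μ) / n) atTop < V := by
  set δ := μ.real {x | block x 0 w.length = w} with hδ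
  have hL : (0 : ℝ) < w.length := Nat.cast_pos.2 (List.length_pos_iff.2 hne)
  have hup : Tendsto (fun n : ℕ => (Vn G H P n : ℝ) / n -
      ((n / w.length : ℕ) : ℝ) / n * δ) atTop (nhds (V - 1 / w.length * δ)) := by
    refine hV.sub (Tendsto.mul_const _ ?_)
    have := (tendsto_nat_floor_div_atTop (R := ℝ)).comp
      ((tendsto_natCast_atTop_atTop (R := ℝ)).atTop_div_const hL)
    have := this.mul_const (1 / (w.length : ℝ))
    rw [one_mul] at this
    refine this.congr fun n => ?_
    simp only [Function.comp, Nat.floor_div_natCast, Nat.floor_natCast]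
    rcases eq_or_ne n 0 with rfl | hn
    · simp
    · field_simp
  refine lt_of_le_of_lt ?_ (sub_lt_self V (mul_pos (one_div_pos.2 hL) hpos))
  rw [← hup.limsup_eq]
  refine limsup_le_limsup (Eventually.of_forall fun n => ?_) ?_ hup.isBoundedUnder_le
  · have := integral_minM_block_add_le hG hK hsupp hinv hw n
    rw [← hδ] at this
    simp only [seg1_eq_block]
    rw [div_mul_eq_mul_div, ← sub_div]
    gcongr
    linarith
  · refine IsBoundedUnder.isCoboundedUnder_le ⟨-|(K : ℝ)|, ?_⟩
    simp only [eventually_map]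
    refine Eventually.of_forall fun n => ?_
    have h : -(|(K : ℝ)| * n) ≤ ∫ x, (minM G P (seg1 x n) : ℝ) ∂μ := by
      calc -(|(K : ℝ)| * n) = ∫ _, -(|(K : ℝ)| * n) ∂μ := by simp
        _ ≤ _ := by
          refine integral_mono (integrable_const _) (integrable_minM_block hG hK μ n) fun x => ?_
          have h := (abs_le.1 (abs_minM_le hG hK (block x 1 n))).1
          rw [length_block] at h
          have h' : -((K : ℝ) * n) ≤ minM G P (block x 1 n) := by exact_mod_cast h
          refine le_trans (neg_le_neg ?_) h'
          gcongr
          exact le_abs_self _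
    rcases eq_or_ne n 0 with rfl | hn
    · simp
    · rw [le_div_iff₀ (by positivity), neg_mul]
      exact h

open MeasureTheory in
theorem ae_mem_XHdag_of_limsup [Finite VG] [Finite EG] [Finite EH] (hG : G.Primitive)
    [Nonempty VH] {K : ℤ} (hK : ∀ e f, |P e f| ≤ K) {V : ℝ}
    (hV : Tendsto (fun n : ℕ => (Vn G H P n : ℝ) / n) atTop (nhds V)) {μ : Measure (ℤ → EH)}
    [IsProbabilityMeasure μ] (hsupp : ∀ᵐ x ∂μ, x ∈ XEdge H)
    (hinv : ∀ A : Set (ℤ → EH), MeasurableSet A → μ (shiftMap ⁻¹' A) = μ A)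
    (hlim : limsup (fun n : ℕ => (∫ x, (minM G P (seg1 x n) : ℝ) ∂μ) / n) atTop = V) :
    ∀ᵐ x ∂μ, x ∈ XHdag G H P := by
  have key : ∀ w w', w ≠ [] → ImprovesBy G H P 1 w w' → ∀ s : ℤ,
      ∀ᵐ x ∂μ, block x s w.length ≠ w := by
    intro w w' hne hw s
    have h0 : μ.real {x | block x 0 w.length = w} = 0 := by
      by_contra h
      exact (limsup_integral_minM_lt hG hK hV hsupp hinv hne hw
        (lt_of_le_of_ne measureReal_nonneg (Ne.symm h))).ne hlim
    rw [ae_iff]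
    simp only [ne_eq, not_not]
    rw [measure_block_eq hinv]
    exact (measureReal_eq_zero_iff).1 h0
  have key' : ∀ w : List EH, ∀ᵐ x ∂μ,
      (w ≠ [] ∧ ∃ w', ImprovesBy G H P 1 w w') → ∀ s : ℤ, block x s w.length ≠ w := by
    intro w
    by_cases h : w ≠ [] ∧ ∃ w', ImprovesBy G H P 1 w w'
    · obtain ⟨w', hw'⟩ := h.2
      filter_upwards [ae_all_iff.2 (key w w' h.1 hw')] with x hx _ using hx
    · exact Eventually.of_forall fun x h' => absurd h' h
  filter_upwards [hsupp, ae_all_iff.2 key'] with x hx hall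
  refine ⟨hx, fun m n hmn => ?_⟩
  rw [seg_eq_block]
  by_contra hcon
  have hne : block x m (n + 1 - m).toNat ≠ [] := by
    rw [← List.length_pos_iff, length_block]
    omega
  refine hall _ ⟨hne, exists_improvesBy_one hne (joins_block hx m _) hcon⟩ m ?_
  rw [length_block]

end Block

open MeasureTheory in
/-- Equivalent characterizations of measures supported on optimal strategies of
Alice: (1a) ↔ (1c) and (1b) ↔ (1c). -/
theorem optimizing_measures_alice {VG EG VH EH : Type} [Fintype VG] [Fintype EG]
    [Fintype VH] [Fintype EH] (G : DirGraph VG EG) (H : DirGraph VH EH)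
    (hG : G.Primitive) (hH : H.Primitive) (P : EG → EH → ℤ) (V : ℝ)
    (hV : Filter.Tendsto (fun n : ℕ => (Vn G H P n : ℝ) / n) Filter.atTop (nhds V))
    (μ : Measure (ℤ → EH)) (hprob : IsProbabilityMeasure μ)
    (hsupp : μ (XEdge H) = 1)
    (hinv : ∀ A : Set (ℤ → EH), MeasurableSet A → μ (shiftMap ⁻¹' A) = μ A) :
    ((μ {x | x ∈ XEdge H ∧ Filter.Tendsto
          (fun n : ℕ => (minM G P (seg1 x n) : ℝ) / n) Filter.atTop (nhds V)} = 1)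
      ↔ μ (XHdag G H P) = 1)
    ∧ ((Filter.limsup
          (fun n : ℕ => (∫ x in XEdge H, (minM G P (seg1 x n) : ℝ) ∂μ) / n)
          Filter.atTop = V)
      ↔ μ (XHdag G H P) = 1) := by
  have := hG.nonempty
  have := hH.nonempty
  obtain ⟨K, hK'⟩ := (Set.finite_range fun ef : EG × EH => |P ef.1 ef.2|).bddAbove
  have hK : ∀ e f, |P e f| ≤ K := fun e f => hK' ⟨(e, f), rfl⟩
  have hX : ∀ᵐ x ∂μ, x ∈ XEdge H := by
    rw [ae_iff]
    exact (prob_compl_eq_zero_iff (measurableSet_XEdge H)).2 hsupp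
  have hrestrict : μ.restrict (XEdge H) = μ := Measure.restrict_eq_self_of_ae_mem hX
  rw [hrestrict]
  set S := {x | x ∈ XEdge H ∧ Filter.Tendsto
    (fun n : ℕ => (minM G P (seg1 x n) : ℝ) / n) Filter.atTop (nhds V)} with hS
  have hca : μ (XHdag G H P) = 1 → μ S = 1 := fun h =>
    le_antisymm prob_le_one (h ▸ measure_mono fun x hx =>
      ⟨hx.1, tendsto_minM_of_mem_XHdag hG hH hK hV hx⟩)
  have hab : μ S = 1 → Filter.limsup
      (fun n : ℕ => (∫ x, (minM G P (seg1 x n) : ℝ) ∂μ) / n) Filter.atTop = V := fun h => by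
    have hSm : MeasurableSet S := (measurableSet_XEdge H).inter <|
      measurableSet_tendsto (nhds V) fun n =>
        (measurable_comp_block (fun l => (minM G P l : ℝ)) 1 n).div_const _
    have hae : ∀ᵐ x ∂μ, x ∈ S := by
      rw [ae_iff]
      exact (prob_compl_eq_zero_iff hSm).2 h
    exact (tendsto_integral_minM hG hK (hae.mono fun x hx => hx.2)).limsup_eq
  have hbc : Filter.limsup
      (fun n : ℕ => (∫ x, (minM G P (seg1 x n) : ℝ) ∂μ) / n) Filter.atTop = V →
      μ (XHdag G H P) = 1 := fun h =>
    (measure_congr (eventuallyEq_univ.2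
      (ae_mem_XHdag_of_limsup hG hK hV hX hinv h))).trans measure_univ
  exact ⟨⟨fun h => hbc (hab h), hca⟩, hbc, fun h => hab (hca h)⟩
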